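/- arXiv:2110.04646 — 3 statements merged into one kernel-verified Lean document; each statement's English description precedes it below -/
import Mathlib

section
/- Let A and B be nonzero torsion-free abelian groups and suppose that G = A × B is homogeneous and fully transitive. Then G is transitive. -/
/-- `n` divides `x` in the group `G`. -/
def Divides {G : Type*} [AddCommGroup G] (n : ℕ) (x : G) : Prop :=
  ∃ z : G, n • z = x

/-- `χ(x) ≤ χ(y)`: every prime-power dividing `x` divides `y`. -/
def HeightLE {G H : Type*} [AddCommGroup G] [AddCommGroup H] (x : G) (y : H) : Prop :=
  ∀ p k : ℕ, p.Prime → Divides (p ^ k) x → Divides (p ^ k) y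

/-- `χ(x) = χ(y)`. -/
def HeightEq {G H : Type*} [AddCommGroup G] [AddCommGroup H] (x : G) (y : H) : Prop :=
  HeightLE x y ∧ HeightLE y x

def FullyTransitive (G : Type*) [AddCommGroup G] : Prop :=
  ∀ x y : G, HeightLE x y → ∃ φ : G →+ G, φ x = y

def KrylovTransitive (G : Type*) [AddCommGroup G] : Prop :=
  ∀ x y : G, HeightEq x y → ∃ φ : G →+ G, φ x = y

def TransitiveGrp (G : Type*) [AddCommGroup G] : Prop :=
  ∀ x y : G, HeightEq x y → ∃ φ : G ≃+ G, φ x = y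

def WeaklyTransitive (G : Type*) [AddCommGroup G] : Prop :=
  ∀ (x y : G) (φ ψ : G →+ G), φ x = y → ψ y = x → ∃ η : G ≃+ G, η x = y

def IsTorsionFreeGrp (G : Type*) [AddCommGroup G] : Prop :=
  ∀ (n : ℤ) (x : G), n ≠ 0 → n • x = 0 → x = 0

/-- `τ(x) ≤ τ(y)`. -/
def TypeLE {G H : Type*} [AddCommGroup G] [AddCommGroup H] (x : G) (y : H) : Prop :=
  ∃ n : ℤ, n ≠ 0 ∧ HeightLE x (n • y)

/-- `τ(x) = τ(y)`. -/
def TypeEq {G H : Type*} [AddCommGroup G] [AddCommGroup H] (x : G) (y : H) : Prop :=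
  TypeLE x y ∧ TypeLE y x

def Homogeneous (G : Type*) [AddCommGroup G] : Prop :=
  ∀ x y : G, x ≠ 0 → y ≠ 0 → TypeEq x y

/-- `π(G)`: primes `p` with `pG ≠ G`. -/
def piSet (G : Type*) [AddCommGroup G] : Set ℕ :=
  {p | p.Prime ∧ ¬ ∀ x : G, ∃ z : G, p • z = x}

theorem tf_cancel {G : Type*} [AddCommGroup G] (h : IsTorsionFreeGrp G) {p : ℕ} (hp : p ≠ 0)
    {a b : G} (e : p • a = p • b) : a = b := by
  have := h (p : ℤ) (a - b) (by exact_mod_cast hp) (by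
    rw [natCast_zsmul, smul_sub, e, sub_self])
  exact sub_eq_zero.mp this

theorem dvd_of_coprime {G : Type*} [AddCommGroup G] {m n : ℕ} (h : Nat.Coprime m n) {w : G}
    (hd : Divides m (n • w)) : Divides m w := by
  obtain ⟨z, hz⟩ := hd
  have hb := Nat.gcd_eq_gcd_ab m n
  rw [h.gcd_eq_one] at hb
  refine ⟨m.gcdA n • w + m.gcdB n • z, ?_⟩
  have : w = ((m : ℤ) * m.gcdA n + n * m.gcdB n) • w := by rw [← hb]; simp
  conv_rhs => rw [this]
  rw [add_smul, mul_smul, natCast_zsmul, smul_add, smul_comm m (m.gcdB n) z, hz, mul_comm,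
    mul_smul, natCast_zsmul]

theorem dvd_smul_of {G : Type*} [AddCommGroup G] {m : ℕ} (n : ℕ) {w : G}
    (hd : Divides m w) : Divides m (n • w) := by
  obtain ⟨z, rfl⟩ := hd
  exact ⟨n • z, smul_comm _ _ _⟩

theorem dvd_pow_succ {G : Type*} [AddCommGroup G] (hG : IsTorsionFreeGrp G) {p j : ℕ}
    (hp : p.Prime) {w : G} : Divides (p ^ (j + 1)) (p • w) → Divides (p ^ j) w := by
  rintro ⟨z, hz⟩
  refine ⟨z, tf_cancel hG hp.ne_zero ?_⟩
  rw [← hz, pow_succ', mul_smul]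

theorem dvd_pow_succ' {G : Type*} [AddCommGroup G] {p j : ℕ}
    {w : G} : Divides (p ^ j) w → Divides (p ^ (j + 1)) (p • w) := by
  rintro ⟨z, hz⟩
  refine ⟨z, ?_⟩
  rw [← hz, pow_succ', mul_smul]

theorem dvd_of_le {G : Type*} [AddCommGroup G] {p j k : ℕ} (h : j ≤ k)
    {w : G} : Divides (p ^ k) w → Divides (p ^ j) w := by
  rintro ⟨z, hz⟩
  refine ⟨p ^ (k - j) • z, ?_⟩
  rw [← hz, ← mul_smul, ← pow_add, Nat.add_sub_cancel' h]

theorem lemR {G H : Type*} [AddCommGroup G] [AddCommGroup H] (hG : IsTorsionFreeGrp G)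
    (hH : IsTorsionFreeGrp H) (v : H) (M : ℕ) (N : ℕ) : N ≠ 0 → ∀ u : G,
    HeightLE u (N • v) → HeightLE v (M • u) →
    ∃ (m : ℕ) (u' : G), u = m • u' ∧ HeightLE u' v ∧ HeightLE v (M • u') := by
  induction N using Nat.strong_induction_on with
  | _ N ih =>
  intro hN u h1 h2
  by_cases hle : HeightLE u v
  · exact ⟨1, u, by simp, hle, h2⟩
  unfold HeightLE at hle
  push Not at hle
  obtain ⟨p, k, hp, hku, hkv⟩ := hle
  have hk : k ≠ 0 := by
    rintro rfl
    exact hkv ⟨v, by simp⟩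
  obtain ⟨u1, hu1⟩ : Divides p u := by
    have := dvd_of_le (j := 1) (Nat.one_le_iff_ne_zero.mpr hk) hku
    simpa using this
  have hpN : p ∣ N := by
    by_contra hnd
    have hc : Nat.Coprime (p ^ k) N := Nat.Coprime.pow_left k ((Nat.Prime.coprime_iff_not_dvd hp).2 hnd)
    exact hkv (dvd_of_coprime hc (h1 p k hp hku))
  obtain ⟨N1, rfl⟩ := hpN
  have hN1 : N1 ≠ 0 := by rintro rfl; simp at hN
  have hlt : N1 < p * N1 := by
    have := hp.two_le
    have : 0 < N1 := Nat.pos_of_ne_zero hN1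
    nlinarith
  have key1 : HeightLE u1 (N1 • v) := by
    intro q j hq hd
    by_cases hqp : q = p
    · subst hqp
      have := h1 q (j + 1) hq (by rw [← hu1]; exact dvd_pow_succ' hd)
      rw [mul_smul] at this
      exact dvd_pow_succ hH hq this
    · have := h1 q j hq (by rw [← hu1]; exact dvd_smul_of p hd)
      rw [mul_smul] at this
      exact dvd_of_coprime (Nat.Coprime.pow_left j ((Nat.coprime_primes hq hp).2 hqp)) this
  have key2 : HeightLE v (M • u1) := by
    intro q j hq hd
    by_cases hqp : q = p
    · subst hqp
      have hjk : j < k := by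
        by_contra hjk
        exact hkv (dvd_of_le (not_lt.mp hjk) hd)
      have := dvd_of_le (j := j + 1) hjk hku
      rw [← hu1] at this
      exact dvd_smul_of M (dvd_pow_succ hG hq this)
    · have := h2 q j hq hd
      rw [← hu1, smul_comm] at this
      exact dvd_of_coprime (Nat.Coprime.pow_left j ((Nat.coprime_primes hq hp).2 hqp)) this
  obtain ⟨m, u', e, hu1', hu2'⟩ := ih N1 hlt hN1 u1 key1 key2
  exact ⟨p * m, u', by rw [← hu1, e, mul_smul], hu1', hu2'⟩

theorem typeLE_nat {G H : Type*} [AddCommGroup G] [AddCommGroup H] {u : G} {v : H}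
    (h : TypeLE u v) : ∃ n : ℕ, n ≠ 0 ∧ HeightLE u (n • v) := by
  obtain ⟨n, hn, hle⟩ := h
  refine ⟨n.natAbs, by simpa using hn, fun p k hp hd => ?_⟩
  obtain ⟨z, hz⟩ := hle p k hp hd
  rcases Int.natAbs_eq n with e | e
  · exact ⟨z, by rw [hz, ← natCast_zsmul, ← e]⟩
  · refine ⟨-z, ?_⟩
    rw [smul_neg, hz, ← natCast_zsmul, ← neg_smul]
    congr 1
    omega

theorem lemK {G H : Type*} [AddCommGroup G] [AddCommGroup H] (hG : IsTorsionFreeGrp G)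
    (hH : IsTorsionFreeGrp H) (u : G) (v : H) (h1 : TypeLE u v) (h2 : TypeLE v u) :
    ∃ (m n : ℕ) (u' : G) (v' : H), u = m • u' ∧ v = n • v' ∧ HeightEq u' v' := by
  obtain ⟨N, hN, h1⟩ := typeLE_nat h1
  obtain ⟨M, hM, h2⟩ := typeLE_nat h2
  obtain ⟨m, u', hu, a1, a2⟩ := lemR hG hH v M N hN u h1 h2
  obtain ⟨n, v', hv, b1, b2⟩ := lemR hH hG u' 1 M hM v a2 (by simpa using a1)
  exact ⟨m, n, u', v', hu, hv, by simpa using b2, b1⟩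

def Reach {G : Type*} [AddCommGroup G] (x y : G) : Prop := ∃ φ : G ≃+ G, φ x = y

theorem Reach.trans' {G : Type*} [AddCommGroup G] {x y z : G} (h : Reach x y) (h' : Reach y z) :
    Reach x z := by
  obtain ⟨φ, rfl⟩ := h
  obtain ⟨ψ, rfl⟩ := h'
  exact ⟨φ.trans ψ, rfl⟩

theorem Reach.symm' {G : Type*} [AddCommGroup G] {x y : G} (h : Reach x y) : Reach y x := by
  obtain ⟨φ, rfl⟩ := h
  exact ⟨φ.symm, by simp⟩

theorem reach_right {A B : Type*} [AddCommGroup A] [AddCommGroup B] (f : A →+ B) (a : A) (b : B) :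
    Reach (a, b) (a, b + f a) :=
  ⟨{ toFun := fun x => (x.1, x.2 + f x.1)
     invFun := fun x => (x.1, x.2 - f x.1)
     left_inv := fun x => by simp
     right_inv := fun x => by simp
     map_add' := fun x y => by
      ext
      · simp
      · simp only [Prod.fst_add, Prod.snd_add, map_add]; abel }, rfl⟩

theorem reach_left {A B : Type*} [AddCommGroup A] [AddCommGroup B] (g : B →+ A) (a : A) (b : B) :
    Reach (a, b) (a + g b, b) :=
  ⟨{ toFun := fun x => (x.1 + g x.2, x.2)
     invFun := fun x => (x.1 - g x.2, x.2)
     left_inv := fun x => by simp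
     right_inv := fun x => by simp
     map_add' := fun x y => by
      ext
      · simp only [Prod.fst_add, Prod.snd_add, map_add]; abel
      · simp }, rfl⟩

theorem reach_swap {A B : Type*} [AddCommGroup A] [AddCommGroup B] (f : A →+ B) (g : B →+ A)
    {a : A} {b : B} (hf : f a = b) (hg : g b = a) : Reach (a, (0 : B)) ((0 : A), b) := by
  have h1 := reach_right f a 0
  have h2 := reach_left g 0 b
  rw [hf, zero_add] at h1
  rw [hg, zero_add] at h2
  exact h1.trans' h2.symm'

theorem reach_euclid {A B : Type*} [AddCommGroup A] [AddCommGroup B] (f : A →+ B) (g : B →+ A)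
    {a : A} {b : B} (hf : f a = b) (hg : g b = a) (s : ℕ) : ∀ m n : ℕ, m + n ≤ s →
    ∃ k : ℕ, Reach (m • a, n • b) (k • a, (0 : B)) := by
  induction s with
  | zero =>
    intro m n h
    obtain ⟨rfl, rfl⟩ : m = 0 ∧ n = 0 := by omega
    exact ⟨0, AddEquiv.refl _, by simp⟩
  | succ s ih =>
    intro m n h
    by_cases hm : m = 0
    · subst hm
      refine ⟨n, ?_⟩
      rw [zero_smul]
      exact (reach_swap f g (by rw [map_nsmul, hf]) (by rw [map_nsmul, hg])).symm'
    by_cases hn : n = 0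
    · subst hn
      exact ⟨m, AddEquiv.refl _, by simp⟩
    rcases le_total m n with hmn | hmn
    · obtain ⟨k, hk⟩ := ih m (n - m) (by omega)
      refine ⟨k, Reach.trans' (Reach.symm' ?_) hk⟩
      have := reach_right f (m • a) ((n - m) • b)
      rwa [map_nsmul, hf, ← add_smul, Nat.sub_add_cancel hmn] at this
    · obtain ⟨k, hk⟩ := ih (m - n) n (by omega)
      refine ⟨k, Reach.trans' (Reach.symm' ?_) hk⟩
      have := reach_left g ((m - n) • a) (n • b)
      rwa [map_nsmul, hg, ← add_smul, Nat.sub_add_cancel hmn] at this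

theorem heightLE_map {G H : Type*} [AddCommGroup G] [AddCommGroup H] (f : G →+ H) (x : G) :
    HeightLE x (f x) := by
  rintro p k - ⟨z, rfl⟩
  exact ⟨f z, by simp⟩

theorem HeightLE.trans' {G H K : Type*} [AddCommGroup G] [AddCommGroup H] [AddCommGroup K]
    {x : G} {y : H} {z : K} (h : HeightLE x y) (h' : HeightLE y z) : HeightLE x z :=
  fun p k hp hd => h' p k hp (h p k hp hd)

theorem heightEq_inl {A : Type*} (B : Type*) [AddCommGroup A] [AddCommGroup B] (a : A) :
    HeightEq a (a, (0 : B)) :=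
  ⟨heightLE_map (AddMonoidHom.inl A B) a, heightLE_map (AddMonoidHom.fst A B) (a, 0)⟩

theorem heightEq_inr (A : Type*) {B : Type*} [AddCommGroup A] [AddCommGroup B] (b : B) :
    HeightEq b ((0 : A), b) :=
  ⟨heightLE_map (AddMonoidHom.inr A B) b, heightLE_map (AddMonoidHom.snd A B) (0, b)⟩

theorem exists_maps {A B : Type*} [AddCommGroup A] [AddCommGroup B]
    (hft : FullyTransitive (A × B)) {a : A} {b : B} (h : HeightEq a b) :
    ∃ (f : A →+ B) (g : B →+ A), f a = b ∧ g b = a := by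
  obtain ⟨φ, hφ⟩ := hft (a, 0) (0, b)
    ((heightEq_inl B a).2.trans' (h.1.trans' (heightEq_inr A b).1))
  obtain ⟨ψ, hψ⟩ := hft (0, b) (a, 0)
    ((heightEq_inr A b).2.trans' (h.2.trans' (heightEq_inl B a).1))
  exact ⟨(AddMonoidHom.snd A B).comp (φ.comp (AddMonoidHom.inl A B)),
    (AddMonoidHom.fst A B).comp (ψ.comp (AddMonoidHom.inr A B)), by simp [hφ], by simp [hψ]⟩

theorem lemT {A B : Type*} [AddCommGroup A] [AddCommGroup B]
    (hhom : Homogeneous (A × B)) {a : A} {b : B} (ha : a ≠ 0) (hb : b ≠ 0) :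
    TypeLE a b ∧ TypeLE b a := by
  obtain ⟨⟨n, hn, h1⟩, ⟨m, hm, h2⟩⟩ := hhom (a, 0) (0, b) (by simpa using ha) (by simpa using hb)
  refine ⟨⟨n, hn, (heightEq_inl B a).1.trans' (h1.trans' ?_)⟩,
    ⟨m, hm, (heightEq_inr A b).1.trans' (h2.trans' ?_)⟩⟩
  · exact heightLE_map (AddMonoidHom.snd A B) (n • ((0 : A), b))
  · exact heightLE_map (AddMonoidHom.fst A B) (m • (a, (0 : B)))

theorem lemP {A B : Type*} [AddCommGroup A] [AddCommGroup B]
    (hA : IsTorsionFreeGrp A) (hB : IsTorsionFreeGrp B)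
    (hA0 : ∃ a : A, a ≠ 0) (hB0 : ∃ b : B, b ≠ 0)
    (hhom : Homogeneous (A × B)) (hft : FullyTransitive (A × B)) (x : A × B) :
    (∃ a : A, Reach x (a, 0)) ∧ ∃ b : B, Reach x (0, b) := by
  obtain ⟨a, b⟩ := x
  obtain ⟨m, n, a', b', ha, hb, he⟩ : ∃ (m n : ℕ) (a' : A) (b' : B),
      a = m • a' ∧ b = n • b' ∧ HeightEq a' b' := by
    obtain ⟨a0, ha0⟩ := hA0
    obtain ⟨b0, hb0⟩ := hB0
    by_cases ha : a = 0
    · by_cases hb : b = 0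
      · obtain ⟨m, n, a', b', -, -, he⟩ := lemK hA hB a0 b0 (lemT hhom ha0 hb0).1 (lemT hhom ha0 hb0).2
        exact ⟨0, 0, a', b', by simpa using ha, by simpa using hb, he⟩
      · obtain ⟨m, n, a', b', -, h, he⟩ := lemK hA hB a0 b (lemT hhom ha0 hb).1 (lemT hhom ha0 hb).2
        exact ⟨0, n, a', b', by simpa using ha, h, he⟩
    · by_cases hb : b = 0
      · obtain ⟨m, n, a', b', h, -, he⟩ := lemK hA hB a b0 (lemT hhom ha hb0).1 (lemT hhom ha hb0).2
        exact ⟨m, 0, a', b', h, by simpa using hb, he⟩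
      · exact lemK hA hB a b (lemT hhom ha hb).1 (lemT hhom ha hb).2
  obtain ⟨f, g, hf, hg⟩ := exists_maps hft he
  obtain ⟨k, hk⟩ := reach_euclid f g hf hg (m + n) m n le_rfl
  rw [← ha, ← hb] at hk
  exact ⟨⟨_, hk⟩, ⟨k • b', hk.trans' (reach_swap f g (by rw [map_nsmul, hf]) (by rw [map_nsmul, hg]))⟩⟩

theorem Reach.height {G : Type*} [AddCommGroup G] {x y : G} (h : Reach x y) : HeightLE x y := by
  obtain ⟨φ, rfl⟩ := h
  exact heightLE_map φ.toAddMonoidHom x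

theorem stmt_4 (A B : Type*) [AddCommGroup A] [AddCommGroup B]
    (hA : IsTorsionFreeGrp A) (hB : IsTorsionFreeGrp B)
    (hA0 : ∃ a : A, a ≠ 0) (hB0 : ∃ b : B, b ≠ 0)
    (hhom : Homogeneous (A × B)) (hft : FullyTransitive (A × B)) :
    TransitiveGrp (A × B) := by
  intro x y hxy
  obtain ⟨a, ha⟩ := (lemP hA hB hA0 hB0 hhom hft x).1
  obtain ⟨b, hb⟩ := (lemP hA hB hA0 hB0 hhom hft y).2
  have hab : HeightEq a b :=
    ⟨(heightEq_inl B a).1.trans' (ha.symm'.height.trans' (hxy.1.trans' (hb.height.trans'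
      (heightEq_inr A b).2))),
     (heightEq_inr A b).1.trans' (hb.symm'.height.trans' (hxy.2.trans' (ha.height.trans'
      (heightEq_inl B a).2)))⟩
  obtain ⟨f, g, hf, hg⟩ := exists_maps hft hab
  exact ha.trans' ((reach_swap f g hf hg).trans' hb.symm')
end

section
/- There exists a torsion-free abelian group G that is Krylov transitive but neither transitive nor fully transitive, and such that its square G × G is also not Krylov transitive. -/
namespace Kry
open Polynomial

abbrev V := ℚ[X] × ℚ

/-- The localization of `ℤ` at `p` as a subring of `ℚ`. -/
def O (p : ℕ) : Subring ℚ where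
  carrier := {a | ∃ m : ℕ, m.Coprime p ∧ ∃ k : ℤ, (m : ℚ) * a = k}
  mul_mem' := by
    rintro a b ⟨m, hm, k, hk⟩ ⟨m', hm', k', hk'⟩
    refine ⟨m * m', Nat.Coprime.mul_left hm hm', k * k', ?_⟩
    push_cast
    rw [← hk, ← hk']; ring
  one_mem' := ⟨1, by simp, 1, by simp⟩
  add_mem' := by
    rintro a b ⟨m, hm, k, hk⟩ ⟨m', hm', k', hk'⟩
    refine ⟨m * m', Nat.Coprime.mul_left hm hm', m' * k + m * k', ?_⟩
    push_cast
    rw [← hk, ← hk']; ring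
  zero_mem' := ⟨1, by simp, 0, by simp⟩
  neg_mem' := by
    rintro a ⟨m, hm, k, hk⟩
    refine ⟨m, hm, -k, ?_⟩
    push_cast
    rw [← hk]; ring

lemma inv_mem_O {p n : ℕ} (h : n.Coprime p) (h0 : n ≠ 0) : (n : ℚ)⁻¹ ∈ O p :=
  ⟨n, h, 1, by have : (n : ℚ) ≠ 0 := by exact_mod_cast h0
               simp [this]⟩

lemma inv_not_mem_O {p : ℕ} (hp : p.Prime) : (p : ℚ)⁻¹ ∉ O p := by
  rintro ⟨m, hm, k, hk⟩
  have h0 : (p : ℚ) ≠ 0 := by exact_mod_cast hp.ne_zero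
  have : (m : ℚ) = k * p := by rw [← hk]; field_simp
  have h2 : (m : ℤ) = k * p := by exact_mod_cast this
  have h3 : p ∣ m := by
    have : (p : ℤ) ∣ m := ⟨k, by rw [h2]; ring⟩
    exact_mod_cast this
  have := Nat.Coprime.eq_one_of_dvd hm.symm h3
  exact hp.one_lt.ne' this

lemma mem_O_cofinite (a : ℚ) : {p : ℕ | p.Prime ∧ a ∉ O p}.Finite := by
  refine (Set.finite_Iic a.den).subset ?_
  rintro p ⟨hp, ha⟩
  by_contra hlt
  simp only [Set.mem_Iic, not_le] at hlt
  apply ha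
  refine ⟨a.den, ?_, a.num, by rw [mul_comm]; exact Rat.mul_den_eq_num a⟩
  exact ((Nat.Prime.coprime_iff_not_dvd hp).2 (fun h => absurd (Nat.le_of_dvd a.pos h) (not_le.2 hlt))).symm

/-- a rational divisible by infinitely many primes vanishes -/
lemma eq_zero_of_inf {S : Set ℕ} (hS : S.Infinite) (hP : ∀ p ∈ S, p.Prime) (a : ℚ)
    (h : ∀ p ∈ S, ∃ b ∈ O p, a = p * b) : a = 0 := by
  by_contra ha
  obtain ⟨p, hpS, hp⟩ := (hS.sdiff (mem_O_cofinite a⁻¹)).nonempty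
  have hpp := hP p hpS
  obtain ⟨b, hb, hab⟩ := h p hpS
  have h1 : a⁻¹ ∈ O p := by
    by_contra h1
    exact hp ⟨hpp, h1⟩
  apply inv_not_mem_O hpp
  have h0 : (p : ℚ) ≠ 0 := by exact_mod_cast hpp.ne_zero
  have hb0 : b ≠ 0 := by rintro rfl; simp at hab; exact ha hab
  have : (p : ℚ)⁻¹ = a⁻¹ * b := by rw [hab]; field_simp
  rw [this]
  exact (O p).mul_mem h1 hb

/-- `p`-integral polynomials -/
noncomputable def EE (p : ℕ) : Subring ℚ[X] := (mapRingHom (O p).subtype).range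

lemma mem_EE {p : ℕ} {f : ℚ[X]} : f ∈ EE p ↔ ∀ n, f.coeff n ∈ O p := by
  have := Polynomial.lifts_iff_coeff_lifts (f := (O p).subtype) f
  rw [Polynomial.mem_lifts] at this
  simpa [EE, RingHom.mem_range] using this

lemma C_mem_EE {p : ℕ} {a : ℚ} (h : a ∈ O p) : C a ∈ EE p := by
  rw [mem_EE]; intro n; rw [coeff_C]; split_ifs
  · exact h
  · exact (O p).zero_mem

lemma X_mem_EE {p : ℕ} : (X : ℚ[X]) ∈ EE p := ⟨X, by simp⟩

lemma mem_EE_cofinite (f : ℚ[X]) : {p : ℕ | p.Prime ∧ f ∉ EE p}.Finite := by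
  have : {p : ℕ | p.Prime ∧ f ∉ EE p} ⊆
      ⋃ n ∈ f.support, {p : ℕ | p.Prime ∧ f.coeff n ∉ O p} := by
    rintro p ⟨hp, hf⟩
    rw [mem_EE] at hf
    push Not at hf
    obtain ⟨n, hn⟩ := hf
    simp only [Set.mem_iUnion]
    refine ⟨n, ?_, hp, hn⟩
    rw [mem_support_iff]
    intro h; rw [h] at hn; exact hn (O p).zero_mem
  exact (Set.Finite.biUnion (Finset.finite_toSet _) (fun n _ => mem_O_cofinite _)).subset this

lemma half_mem {p : ℕ} (hp : p.Prime) (h2 : p ≠ 2) : (1 / 2 : ℚ) ∈ O p := by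
  have := inv_mem_O (p := p) (n := 2) ((Nat.coprime_primes Nat.prime_two hp).2 h2.symm) (by norm_num)
  simpa using this

lemma eval_mem {p : ℕ} (hp : p.Prime) (h2 : p ≠ 2) {e : ℚ[X]} (he : e ∈ EE p) :
    e.eval (1 / 2) ∈ O p := by
  obtain ⟨e0, rfl⟩ := he
  have : (eval (1/2 : ℚ) (mapRingHom (O p).subtype e0)) =
      (O p).subtype (eval ⟨1/2, half_mem hp h2⟩ e0) := by
    rw [coe_mapRingHom, eval_map, ← Polynomial.eval₂_at_apply]; rfl
  rw [this]
  exact Subtype.mem _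

/-- division with remainder by a monic integral polynomial -/
lemma div_integral {p : ℕ} {f l : ℚ[X]} (hf : f.Monic) (hfE : f ∈ EE p) (hl : l ∈ EE p) :
    l /ₘ f ∈ EE p ∧ l %ₘ f ∈ EE p := by
  obtain ⟨f0, rfl⟩ := hfE
  obtain ⟨l0, rfl⟩ := hl
  have hm : f0.Monic := by
    rw [coe_mapRingHom] at hf
    exact Polynomial.monic_of_injective (Subtype.val_injective) hf
  constructor
  · exact ⟨l0 /ₘ f0, by simp [Polynomial.map_divByMonic _ hm]⟩
  · exact ⟨l0 %ₘ f0, by simp [Polynomial.map_modByMonic _ hm]⟩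

noncomputable def act (a : ℚ[X]) (z : V) : V := (a * z.1, a.eval (1/2) * z.2)

def LL (p : ℕ) : AddSubgroup V where
  carrier := {z | z.1 ∈ EE p ∧ (p ≠ 2 → z.2 ∈ O p)}
  add_mem' := by
    rintro a b ⟨h1, h2⟩ ⟨h3, h4⟩
    exact ⟨(EE p).add_mem h1 h3, fun h => (O p).add_mem (h2 h) (h4 h)⟩
  zero_mem' := ⟨(EE p).zero_mem, fun _ => (O p).zero_mem⟩
  neg_mem' := by
    rintro a ⟨h1, h2⟩
    exact ⟨(EE p).neg_mem h1, fun h => (O p).neg_mem (h2 h)⟩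

lemma act_LL {p : ℕ} (hp : p.Prime) {e : ℚ[X]} (he : e ∈ EE p) {z : V} (hz : z ∈ LL p) :
    act e z ∈ LL p :=
  ⟨(EE p).mul_mem he hz.1, fun h => (O p).mul_mem (eval_mem hp h he) (hz.2 h)⟩

lemma act_add (a : ℚ[X]) (x y : V) : act a (x + y) = act a x + act a y := by
  simp [act, mul_add]
lemma act_sub (a : ℚ[X]) (x y : V) : act a (x - y) = act a x - act a y := by
  simp [act, mul_sub]
lemma add_act (a b : ℚ[X]) (x : V) : act (a + b) x = act a x + act b x := by
  simp [act, add_mul]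
lemma mul_act (a b : ℚ[X]) (x : V) : act (a * b) x = act a (act b x) := by
  simp [act, mul_assoc]
lemma neg_act (a : ℚ[X]) (x : V) : act (-a) x = -act a x := by
  simp [act]
lemma one_act (x : V) : act 1 x = x := by simp [act]
lemma zero_act (x : V) : act 0 x = 0 := by simp [act]
lemma act_zero (a : ℚ[X]) : act a 0 = 0 := by simp [act]
lemma C_act (c : ℚ) (x : V) : act (C c) x = c • x := by
  ext1 <;> simp [act, smul_eq_C_mul]

lemma LL_cofinite (z : V) : {p : ℕ | p.Prime ∧ z ∉ LL p}.Finite := by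
  refine ((mem_EE_cofinite z.1).union (mem_O_cofinite z.2)).subset ?_
  rintro p ⟨hp, hz⟩
  by_contra h
  simp only [Set.mem_union, Set.mem_ofPred_eq, not_or, not_and, not_not] at h
  exact hz ⟨h.1 hp, fun _ => h.2 hp⟩

/-- the relation `y ∈ E_p x + p L_p` -/
def Near (p : ℕ) (x y : V) : Prop := ∃ e ∈ EE p, ∃ l ∈ LL p, y = act e x + (p : ℚ) • l

/-- Scaling `x`. -/
lemma key_monic {S : Set ℕ} (hS : S.Infinite) (hP : ∀ p ∈ S, p.Prime) (x y : V)
    (hx : x.1.Monic) (h : ∀ p ∈ S, Near p x y) : ∃ a, y = act a x := by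
  obtain ⟨f, g⟩ := x
  obtain ⟨f', g'⟩ := y
  simp only at hx
  set q := f' /ₘ f with hq
  set r := f' %ₘ f with hr
  have hdiv : r + f * q = f' := modByMonic_add_div f' f
  have hdr : r.degree < f.degree := degree_modByMonic_lt _ hx
  have main : ∀ p ∈ S, f ∈ EE p → q ∈ EE p → (g ∈ O p) → p ≠ 2 →
      (∃ r1 ∈ EE p, r = C (p : ℚ) * r1) ∧ ∃ b ∈ O p, g' - q.eval (1/2) * g = p * b := by
    intro p hpS hfE hqE hg h2
    obtain ⟨e, he, ⟨l1, l2⟩, ⟨hl1, hl2⟩, hy⟩ := h p hpS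
    simp only [act, Prod.mk.injEq, Prod.smul_mk, Prod.mk_add_mk, smul_eq_mul, smul_eq_C_mul] at hy hl1 hl2
    obtain ⟨hy1, hy2⟩ := hy
    obtain ⟨hq1, hr1⟩ := div_integral hx hfE hl1
    have hld : l1 %ₘ f + f * (l1 /ₘ f) = l1 := modByMonic_add_div l1 f
    have hlr : (l1 %ₘ f).degree < f.degree := degree_modByMonic_lt _ hx
    have hu := div_modByMonic_unique (f := f') (e + C (p : ℚ) * (l1 /ₘ f)) (C (p : ℚ) * (l1 %ₘ f)) hx
      ⟨by rw [hy1]; nth_rewrite 3 [← hld]; ring, by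
        refine lt_of_le_of_lt ?_ hlr
        rw [← smul_eq_C_mul]; exact degree_smul_le _ _⟩
    refine ⟨⟨_, hr1, hu.2⟩, l2 - (l1 /ₘ f).eval (1/2) * g, ?_, ?_⟩
    · exact (O p).sub_mem (hl2 h2) ((O p).mul_mem (eval_mem (hP p hpS) h2 hq1) hg)
    · rw [hq, hu.1, hy2]; simp; ring
  set T := S \ ({p | p.Prime ∧ f ∉ EE p} ∪ {p | p.Prime ∧ q ∉ EE p} ∪ {p | p.Prime ∧ g ∉ O p} ∪ {2}) with hT
  have hTi : T.Infinite := hS.sdiff ((((mem_EE_cofinite f).union (mem_EE_cofinite q)).union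
    (mem_O_cofinite g)).union (Set.finite_singleton 2))
  have hTm : ∀ p ∈ T, p.Prime ∧ (∃ r1 ∈ EE p, r = C (p : ℚ) * r1) ∧ ∃ b ∈ O p, g' - q.eval (1/2) * g = p * b := by
    rintro p ⟨hpS, hn⟩
    have hp := hP p hpS
    simp only [Set.mem_union, Set.mem_ofPred_eq, Set.mem_singleton_iff, not_or, not_and, not_not] at hn
    exact ⟨hp, main p hpS (hn.1.1.1 hp) (hn.1.1.2 hp) (hn.1.2 hp) hn.2⟩
  have hr0 : r = 0 := by
    ext n
    rw [coeff_zero]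
    refine eq_zero_of_inf hTi (fun p hp => (hTm p hp).1) _ ?_
    intro p hp
    obtain ⟨r1, hr1, h1⟩ := (hTm p hp).2.1
    exact ⟨r1.coeff n, mem_EE.1 hr1 n, by rw [h1, coeff_C_mul]⟩
  have hg0 := eq_zero_of_inf hTi (fun p hp => (hTm p hp).1) _ (fun p hp => (hTm p hp).2.2)
  refine ⟨q, ?_⟩
  simp only [act, Prod.mk.injEq]
  refine ⟨by rw [← hdiv, hr0]; ring, by linarith⟩

lemma key {S : Set ℕ} (hS : S.Infinite) (hP : ∀ p ∈ S, p.Prime) (x y : V)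
    (hx0 : x ≠ 0) (h : ∀ p ∈ S, Near p x y) : ∃ a, y = act a x := by
  by_cases hx : x.1 = 0
  · have hx2 : x.2 ≠ 0 := fun h' => hx0 (Prod.ext hx h')
    have hy : y.1 = 0 := by
      ext n
      rw [coeff_zero]
      refine eq_zero_of_inf hS hP _ ?_
      intro p hp
      obtain ⟨e, he, l, hl, hy⟩ := h p hp
      refine ⟨l.1.coeff n, mem_EE.1 hl.1 n, ?_⟩
      rw [hy]; simp [act, hx]
    refine ⟨C (y.2 / x.2), ?_⟩
    rw [C_act]
    ext1
    · simp [hx, hy]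
    · simp [hx2]
  · have hc : x.1.leadingCoeff ≠ 0 := leadingCoeff_ne_zero.2 hx
    set c := x.1.leadingCoeff with hcdef
    have hm : (c⁻¹ • x).1.Monic := by
      simp only [Prod.smul_fst, smul_eq_C_mul]
      rw [mul_comm]
      exact monic_mul_leadingCoeff_inv hx
    have hxc : x = act (C c) (c⁻¹ • x) := by rw [C_act, smul_smul, mul_inv_cancel₀ hc, one_smul]
    have hSi := hS.sdiff (mem_O_cofinite c)
    obtain ⟨a, ha⟩ := key_monic hSi (fun p hp => hP p hp.1) (c⁻¹ • x) y hm (by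
      rintro p ⟨hp, hn⟩
      obtain ⟨e, he, l, hl, hy⟩ := h p hp
      have hcO : c ∈ O p := by
        by_contra h'
        exact hn ⟨hP p hp, h'⟩
      refine ⟨e * C c, (EE p).mul_mem he (C_mem_EE hcO), l, hl, ?_⟩
      rw [mul_act, ← hxc, hy])
    refine ⟨a * C c⁻¹, ?_⟩
    rw [mul_act, C_act, ha]

noncomputable def v0 : V := (1, 0)

def Skip (w : V) : Prop := ∃ c : ℚ, w = c • v0

lemma skip_of_act {a : ℚ[X]} {w : V} {c : ℚ} (hc : c ≠ 0) (h : c • v0 = act a w) : Skip w := by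
  have h1 : C c = a * w.1 := by
    have := congrArg Prod.fst h
    simpa [v0, act, smul_eq_C_mul] using this
  have h2 : a.eval (1/2) * w.2 = 0 := by
    have := congrArg Prod.snd h
    simpa [v0, act] using this.symm
  have hu : IsUnit (a * w.1) := by rw [← h1]; exact isUnit_C.2 hc.isUnit
  have hua := isUnit_of_mul_isUnit_left hu
  have huw := isUnit_of_mul_isUnit_right hu
  obtain ⟨d, hd, rfl⟩ := Polynomial.isUnit_iff.1 hua
  obtain ⟨d', hd', hw⟩ := Polynomial.isUnit_iff.1 huw
  refine ⟨d', ?_⟩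
  ext1
  · simp [v0, ← hw, smul_eq_C_mul]
  · simp only [eval_C, mul_eq_zero, hd.ne_zero, false_or] at h2
    simp [v0, h2]

lemma not_near_zero {p : ℕ} (hp : p.Prime) : ¬ Near p 0 v0 := by
  rintro ⟨e, he, l, hl, h⟩
  rw [act_zero, zero_add] at h
  have h1 := congrArg (fun z : V => z.1.coeff 0) h
  simp [v0] at h1
  have h0 : (p : ℚ) ≠ 0 := by exact_mod_cast hp.ne_zero
  have : l.1.coeff 0 = (p : ℚ)⁻¹ := by field_simp; linarith
  apply inv_not_mem_O hp
  rw [← this]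
  exact mem_EE.1 hl.1 0

instance : Countable ℚ[X] := by
  have : Function.Injective (fun f : ℚ[X] => f.toFinsupp) := Polynomial.toFinsupp_injective
  have h2 : Countable (ℕ →₀ ℚ) := inferInstance
  exact Function.Injective.countable (f := fun f : ℚ[X] => (Finsupp.ofSupportFinite f.coeff
    (f.support.finite_toSet.subset (by intro n hn; simpa using hn)) : ℕ →₀ ℚ)) (by
      intro f g h
      ext n
      exact DFunLike.congr_fun h n)

lemma exists_v : ∃ v : ℕ → V, (∀ p, p.Prime → v p ∈ LL p ∧ ¬ Near p (v p) v0) ∧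
    ∀ w, ¬ Skip w → {p : ℕ | p.Prime ∧ v p = w}.Infinite := by
  classical
  have : Nonempty (V × ℕ) := ⟨0⟩
  obtain ⟨s, hs⟩ := exists_surjective_nat (V × ℕ)
  let w : ℕ → V := fun p => (s (Nat.count Nat.Prime p)).1
  have hw : ∀ z : V, {p : ℕ | p.Prime ∧ w p = z}.Infinite := by
    intro z
    choose t ht using fun n : ℕ => hs (z, n)
    have hti : Function.Injective t := by
      intro a b hab
      have h1 := ht a
      rw [hab, ht b] at h1
      simpa using h1.symm
    refine (Set.infinite_range_of_injective (f := fun n => Nat.nth Nat.Prime (t n)) ?_).mono ?_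
    · exact (Nat.nth_injective Nat.infinite_setOfPred_prime).comp hti
    · rintro _ ⟨n, rfl⟩
      refine ⟨Nat.prime_nth_prime _, ?_⟩
      simp only [w]
      rw [Nat.count_nth_of_infinite Nat.infinite_setOfPred_prime, ht]
  refine ⟨fun p => if w p ∈ LL p ∧ ¬ Near p (w p) v0 then w p else 0, ?_, ?_⟩
  · intro p hp
    dsimp only
    split_ifs with h
    · exact h
    · exact ⟨(LL p).zero_mem, not_near_zero hp⟩
  · intro z hz
    have hz0 : z ≠ 0 := by rintro rfl; exact hz ⟨0, by simp⟩
    have hfin : {p : ℕ | p.Prime ∧ Near p z v0}.Finite := by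
      by_contra hinf
      obtain ⟨a, ha⟩ := key (S := {p : ℕ | p.Prime ∧ Near p z v0}) hinf (fun p hp => hp.1) z v0 hz0
        (fun p hp => hp.2)
      exact hz (skip_of_act (c := 1) one_ne_zero (by rw [one_smul]; exact ha))
    refine (((hw z).sdiff hfin).sdiff (LL_cofinite z)).mono ?_
    rintro p ⟨⟨⟨hp, h1⟩, h2⟩, h3⟩
    refine ⟨hp, ?_⟩
    simp only [Set.mem_ofPred_eq, not_and, not_not] at h2 h3
    dsimp only
    rw [h1, if_pos ⟨h3 hp, h2 hp⟩]

def Loc (v : ℕ → V) (p : ℕ) (z : V) : Prop :=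
  ∃ e ∈ EE p, z - act (C (p : ℚ)⁻¹ * e) (v p) ∈ LL p

lemma loc_act {v : ℕ → V} {p : ℕ} (hp : p.Prime) {a : ℚ[X]} (ha : a ∈ EE p) {z : V}
    (hz : Loc v p z) : Loc v p (act a z) := by
  obtain ⟨e, he, h⟩ := hz
  refine ⟨a * e, (EE p).mul_mem ha he, ?_⟩
  have := act_LL hp ha h
  rw [act_sub, ← mul_act] at this
  rwa [show C (p : ℚ)⁻¹ * (a * e) = a * (C (p : ℚ)⁻¹ * e) by ring]

lemma loc_of_LL {v : ℕ → V} {p : ℕ} {z : V} (hz : z ∈ LL p) : Loc v p z :=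
  ⟨0, (EE p).zero_mem, by simpa [zero_act] using hz⟩

def GG (v : ℕ → V) : AddSubgroup V where
  carrier := {z | ∀ p : ℕ, p.Prime → Loc v p z}
  add_mem' := by
    intro a b ha hb p hp
    obtain ⟨e, he, h⟩ := ha p hp
    obtain ⟨e', he', h'⟩ := hb p hp
    refine ⟨e + e', (EE p).add_mem he he', ?_⟩
    have := (LL p).add_mem h h'
    rw [mul_add, add_act]
    convert this using 1
    abel
  zero_mem' := fun p _ => loc_of_LL (LL p).zero_mem
  neg_mem' := by
    intro a ha p hp
    have := loc_act hp ((EE p).neg_mem (EE p).one_mem) (ha p hp)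
    rwa [neg_act, one_act] at this

lemma mem_GG {v : ℕ → V} {z : V} : z ∈ GG v ↔ ∀ p : ℕ, p.Prime → Loc v p z := Iff.rfl

section
variable {v : ℕ → V}

lemma act_mem {a : ℚ[X]} (ha : ∀ p : ℕ, p.Prime → a ∈ EE p) {z : V} (hz : z ∈ GG v) :
    act a z ∈ GG v := fun p hp => loc_act hp (ha p hp) (hz p hp)

/-- the endomorphism given by an integral polynomial -/
noncomputable def endo (a : ℚ[X]) (ha : ∀ p : ℕ, p.Prime → a ∈ EE p) : GG v →+ GG v where
  toFun z := ⟨act a z.1, act_mem ha z.2⟩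
  map_zero' := by ext1; simp [act_zero]
  map_add' x y := by ext1; simp [act_add]

lemma dvd_iff {n : ℕ} {x : GG v} : Divides n x ↔ ∃ z ∈ GG v, (n : ℚ) • z = x.1 := by
  constructor
  · rintro ⟨z, rfl⟩
    exact ⟨z.1, z.2, by rw [Nat.cast_smul_eq_nsmul]; rfl⟩
  · rintro ⟨z, hz, h⟩
    refine ⟨⟨z, hz⟩, ?_⟩
    ext1
    rw [← h, Nat.cast_smul_eq_nsmul]; rfl

lemma dvd_of_v {p : ℕ} (hp : p.Prime) {x : GG v} (hx : v p = x.1) : Divides p x := by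
  have h0 : (p : ℚ) ≠ 0 := by exact_mod_cast hp.ne_zero
  rw [dvd_iff]
  refine ⟨act (C (p : ℚ)⁻¹) x.1, ?_, by rw [C_act, smul_smul, mul_inv_cancel₀ h0, one_smul]⟩
  intro q hq
  by_cases hqp : q = p
  · subst hqp
    refine ⟨1, (EE q).one_mem, ?_⟩
    rw [mul_one, hx, sub_self]; exact (LL q).zero_mem
  · exact loc_act hq (C_mem_EE (inv_mem_O ((Nat.coprime_primes hp hq).2 (Ne.symm hqp)) hp.ne_zero))
      (x.2 q hq)

lemma near_of_dvd {p : ℕ} (hp : p.Prime) {y : GG v} (h : Divides p y) : Near p (v p) y.1 := by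
  have h0 : (p : ℚ) ≠ 0 := by exact_mod_cast hp.ne_zero
  obtain ⟨z, hz, h⟩ := dvd_iff.1 h
  obtain ⟨e, he, hl⟩ := hz p hp
  refine ⟨e, he, _, hl, ?_⟩
  rw [smul_sub, h, mul_act, C_act, smul_smul, mul_inv_cancel₀ h0, one_smul]
  abel

lemma typ (hv2 : ∀ w, ¬ Skip w → {p : ℕ | p.Prime ∧ v p = w}.Infinite) {x y : GG v}
    (hx : ¬ Skip x.1) (h : HeightLE x y) : ∃ a, y.1 = act a x.1 := by
  refine key (hv2 _ hx) (fun p hp => hp.1) _ _ ?_ ?_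
  · intro h'; exact hx ⟨0, by simp [h']⟩
  · rintro p ⟨hp, hpx⟩
    have h1 := h p 1 hp (by rw [pow_one]; exact dvd_of_v hp hpx)
    rw [pow_one] at h1
    have := near_of_dvd hp h1
    rwa [hpx] at this

lemma heightLE_map {G H : Type*} [AddCommGroup G] [AddCommGroup H] (f : G →+ H) (x : G) :
    HeightLE x (f x) := by
  rintro p k _ ⟨z, rfl⟩
  exact ⟨f z, by rw [map_nsmul]⟩

/-- bounded height -/
lemma coeff_of_dvd (hv1 : ∀ p, p.Prime → v p ∈ LL p) {p : ℕ} (hp : p.Prime) {x : GG v}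
    {k : ℕ} (h : Divides (p ^ k) x) :
    ∃ l ∈ LL p, (p : ℚ) • x.1 = ((p : ℚ) ^ k) • l := by
  have h0 : (p : ℚ) ≠ 0 := by exact_mod_cast hp.ne_zero
  obtain ⟨z, hz, h⟩ := dvd_iff.1 h
  obtain ⟨e, he, hl⟩ := hz p hp
  refine ⟨(p : ℚ) • z, ?_, by rw [← h]; push_cast; rw [smul_comm]⟩
  have h1 : p • (z - act (C (p : ℚ)⁻¹ * e) (v p)) ∈ LL p := (LL p).nsmul_mem hl p
  have h2 := (LL p).add_mem h1 (act_LL hp he (hv1 p hp))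
  rw [← Nat.cast_smul_eq_nsmul ℚ, smul_sub, mul_act, C_act, smul_smul, mul_inv_cancel₀ h0, one_smul,
    sub_add_cancel] at h2
  exact h2

lemma rat_zero {p : ℕ} (hp : p.Prime) (a : ℚ) (h : ∀ k : ℕ, ∃ b ∈ O p, (p : ℚ) * a = p ^ k * b) :
    a = 0 := by
  by_contra ha
  have h0 : (p : ℚ) ≠ 0 := by exact_mod_cast hp.ne_zero
  have key : ∀ k : ℕ, (p : ℤ) ^ k ∣ a.num := by
    intro k
    obtain ⟨b, ⟨m, hm, n, hn⟩, hb⟩ := h (k + 1)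
    have h1 : a = p ^ k * b := by
      rw [pow_succ] at hb
      have : (p : ℚ) * a = p * (p ^ k * b) := by rw [hb]; ring
      exact mul_left_cancel₀ h0 this
    have h2 : (m : ℚ) * a.num = p ^ k * n * a.den := by
      rw [← hn, ← Rat.mul_den_eq_num a]
      nth_rewrite 1 [h1]; ring
    have h3 : (m : ℤ) * a.num = p ^ k * n * a.den := by exact_mod_cast h2
    have hc : IsCoprime ((p : ℤ) ^ k) (m : ℤ) :=
      IsCoprime.pow_left (Nat.isCoprime_iff_coprime.2 hm.symm)
    exact hc.dvd_of_dvd_mul_left ⟨n * a.den, by rw [h3]; ring⟩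
  have hn : a.num ≠ 0 := Rat.num_ne_zero.2 ha
  obtain ⟨k, hk⟩ := Nat.exists_eq_pow_mul_and_not_dvd (Int.natAbs_ne_zero.2 hn) p hp.ne_one
  obtain ⟨m, hm, hk⟩ := hk
  apply hm
  have h4 := Int.natAbs_dvd_natAbs.2 (key (k + 1))
  rw [Int.natAbs_pow, Int.natAbs_natCast, hk, pow_succ] at h4
  exact Nat.dvd_of_mul_dvd_mul_left (pow_pos hp.pos k) h4

lemma fst_zero (hv1 : ∀ p, p.Prime → v p ∈ LL p) {p : ℕ} (hp : p.Prime) {x : GG v}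
    (h : ∀ k, Divides (p ^ k) x) : x.1.1 = 0 := by
  ext n
  rw [coeff_zero]
  refine rat_zero hp _ fun k => ?_
  obtain ⟨l, hl, h1⟩ := coeff_of_dvd hv1 hp (h k)
  refine ⟨l.1.coeff n, mem_EE.1 hl.1 n, ?_⟩
  have := congrArg (fun z : V => z.1.coeff n) h1
  simpa using this

lemma snd_zero (hv1 : ∀ p, p.Prime → v p ∈ LL p) {p : ℕ} (hp : p.Prime) (h2 : p ≠ 2) {x : GG v}
    (h : ∀ k, Divides (p ^ k) x) : x.1.2 = 0 := by
  refine rat_zero hp _ fun k => ?_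
  obtain ⟨l, hl, h1⟩ := coeff_of_dvd hv1 hp (h k)
  refine ⟨l.2, hl.2 h2, ?_⟩
  have := congrArg (fun z : V => z.2) h1
  simpa using this

lemma inf_height {G : Type*} [AddCommGroup G] {x y : G} {p : ℕ} (hp : p.Prime) {a b : ℤ}
    (hab : b • y = a • x) (ha : (p : ℤ) ∣ a) (hb : IsCoprime (p : ℤ) b) (h : HeightEq x y) :
    ∀ k, Divides (p ^ k) x := by
  intro k
  induction k with
  | zero => exact ⟨x, by simp⟩
  | succ k ih =>
    obtain ⟨z, hz⟩ := ih
    obtain ⟨a', rfl⟩ := ha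
    apply h.2 p (k + 1) hp
    obtain ⟨s, t, hst⟩ := IsCoprime.pow_left (m := k + 1) hb
    refine ⟨s • y + (t * a') • z, ?_⟩
    calc p ^ (k + 1) • (s • y + (t * a') • z)
        = (s * (p : ℤ) ^ (k + 1)) • y + t • ((p * a') • (p ^ k • z)) := by
          rw [← natCast_zsmul, ← natCast_zsmul, smul_add, smul_smul, smul_smul, smul_smul, smul_smul]
          push_cast
          congr 2 <;> ring
      _ = (s * (p : ℤ) ^ (k + 1)) • y + t • (b • y) := by rw [hz, hab]
      _ = y := by rw [smul_smul, ← add_smul, hst, one_smul]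

lemma rat_smul_iff {c : ℚ} {x y : GG v} (h : y.1 = c • x.1) : (c.den : ℤ) • y = c.num • x := by
  ext1
  push_cast
  rw [h, ← Int.cast_smul_eq_zsmul ℚ, ← Int.cast_smul_eq_zsmul ℚ, smul_smul]
  congr 1
  have := Rat.mul_den_eq_num c
  push_cast; linarith

lemma pow_two_of {n : ℕ} (hn : n ≠ 0) (h : ∀ p : ℕ, p.Prime → p ∣ n → p = 2) :
    ∃ i, n = 2 ^ i :=
  ⟨_, Nat.eq_prime_pow_of_unique_prime_dvd hn (fun {d} hd hdn => h d hd hdn)⟩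

lemma finish (hv1 : ∀ p, p.Prime → v p ∈ LL p) {x y : GG v} (hx : x ≠ 0) (h : HeightEq x y)
    {c : ℚ} (hc : c ≠ 0) (hcy : y.1 = c • x.1) : ∃ φ : GG v →+ GG v, φ x = y := by
  have hab := rat_smul_iff hcy
  have hcop : IsCoprime c.num (c.den : ℤ) := by
    rw [Int.isCoprime_iff_gcd_eq_one]; exact c.reduced
  have hy : y ≠ 0 := by
    rintro rfl
    have : c • x.1 = 0 := hcy.symm
    rw [smul_eq_zero] at this
    rcases this with h | h
    · exact hc h
    · exact hx (Subtype.ext h)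
  have hnum : ∀ p : ℕ, p.Prime → p ∣ c.num.natAbs → ∀ k, Divides (p ^ k) x := by
    intro p hp hd
    have hd' : (p : ℤ) ∣ c.num := Int.natCast_dvd.2 hd
    exact inf_height hp hab hd' (hcop.of_isCoprime_of_dvd_left hd') h
  have hden : ∀ p : ℕ, p.Prime → p ∣ c.den → ∀ k, Divides (p ^ k) x := by
    intro p hp hd k
    have hd' : (p : ℤ) ∣ c.den := Int.natCast_dvd_natCast.2 hd
    exact h.2 p k hp (inf_height hp hab.symm hd' (hcop.symm.of_isCoprime_of_dvd_left hd') ⟨h.2, h.1⟩ k)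
  have hbad : ∀ p : ℕ, p.Prime → (∀ k, Divides (p ^ k) x) → x.1.1 = 0 ∧ p = 2 := by
    intro p hp hk
    have h1 := fst_zero hv1 hp hk
    refine ⟨h1, ?_⟩
    by_contra h2
    exact hx (Subtype.ext (Prod.ext h1 (snd_zero hv1 hp h2 hk)))
  obtain ⟨i, hi⟩ := pow_two_of (Int.natAbs_ne_zero.2 (Rat.num_ne_zero.2 hc))
    (fun p hp hd => (hbad p hp (hnum p hp hd)).2)
  obtain ⟨j, hj⟩ := pow_two_of c.den_nz (fun p hp hd => (hbad p hp (hden p hp hd)).2)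
  -- the endomorphism
  refine ⟨endo (C (c.num : ℚ) * X ^ j) ?_, ?_⟩
  · intro p hp
    exact (EE p).mul_mem (C_mem_EE (intCast_mem (O p) _)) ((EE p).pow_mem X_mem_EE j)
  · ext1
    simp only [endo, AddMonoidHom.coe_mk, ZeroHom.coe_mk]
    rw [hcy]
    by_cases h0 : x.1.1 = 0
    · ext1
      · simp [act, h0]
      · simp only [act, eval_mul, eval_C, eval_pow, eval_X, Prod.smul_snd, smul_eq_mul]
        congr 1
        have h3 : (c.den : ℚ) = 2 ^ j := by rw [hj]; push_cast; rfl
        nth_rewrite 2 [← Rat.num_div_den c]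
        rw [h3]; field_simp; simp
    · have hj0 : j = 0 := by
        by_contra hj0
        exact h0 (hbad 2 Nat.prime_two (hden 2 Nat.prime_two (by rw [hj]; exact dvd_pow_self 2 hj0))).1
      subst hj0
      rw [pow_zero, mul_one, C_act]
      congr 1
      nth_rewrite 2 [← Rat.num_div_den c]
      rw [hj]; simp

lemma eq_zero_of_all (hv1 : ∀ p, p.Prime → v p ∈ LL p) {x : GG v} (h : HeightLE (0 : GG v) x) :
    x = 0 := by
  have : ∀ k, Divides (3 ^ k) x := fun k => h 3 k Nat.prime_three ⟨0, by simp⟩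
  exact Subtype.ext (Prod.ext (fst_zero hv1 Nat.prime_three this)
    (snd_zero hv1 Nat.prime_three (by norm_num) this))

lemma krylov (hv1 : ∀ p, p.Prime → v p ∈ LL p)
    (hv2 : ∀ w, ¬ Skip w → {p : ℕ | p.Prime ∧ v p = w}.Infinite) : KrylovTransitive (GG v) := by
  intro x y h
  by_cases hx : x = 0
  · subst hx
    exact ⟨0, by rw [eq_zero_of_all hv1 h.1]; simp⟩
  by_cases hy : y = 0
  · exact ⟨0, by simp [hy]⟩
  have hx' : x.1 ≠ 0 := fun h => hx (Subtype.ext h)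
  have hy' : y.1 ≠ 0 := fun h => hy (Subtype.ext h)
  suffices ∃ c : ℚ, c ≠ 0 ∧ y.1 = c • x.1 by
    obtain ⟨c, hc, hcy⟩ := this
    exact finish hv1 hx h hc hcy
  by_cases sx : Skip x.1
  · obtain ⟨c, hc⟩ := sx
    have hc0 : c ≠ 0 := by rintro rfl; simp at hc; exact hx hc
    by_cases sy : Skip y.1
    · obtain ⟨d, hd⟩ := sy
      have hd0 : d ≠ 0 := by rintro rfl; simp at hd; exact hy hd
      refine ⟨d / c, div_ne_zero hd0 hc0, ?_⟩
      rw [hc, hd, smul_smul, div_mul_cancel₀ _ hc0]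
    · obtain ⟨a, ha⟩ := typ hv2 sy h.2
      rw [hc] at ha
      exact absurd (skip_of_act hc0 ha) sy
  · obtain ⟨a, ha⟩ := typ hv2 sx h.1
    by_cases sy : Skip y.1
    · obtain ⟨d, hd⟩ := sy
      have hd0 : d ≠ 0 := by rintro rfl; simp at hd; exact hy hd
      rw [hd] at ha
      exact absurd (skip_of_act hd0 ha) sx
    · obtain ⟨b, hb⟩ := typ hv2 sy h.2
      by_cases h0 : x.1.1 = 0
      · refine ⟨a.eval (1/2), ?_, ?_⟩
        · intro h1
          apply hy'
          rw [ha]; ext1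
          · simp [act, h0]
          · simp only [act, h1]; simp
        · rw [ha]; ext1
          · simp [act, h0]
          · simp [act]
      · have h1 : b * a * x.1.1 = 1 * x.1.1 := by
          have := congrArg Prod.fst hb
          rw [ha] at this
          simp only [act] at this
          rw [mul_assoc, ← this, one_mul]
        have h2 := mul_right_cancel₀ h0 h1
        have hu : IsUnit a := IsUnit.of_mul_eq_one b (by rw [mul_comm]; exact h2)
        obtain ⟨c, hc, rfl⟩ := Polynomial.isUnit_iff.1 hu
        exact ⟨c, hc.ne_zero, by rw [ha, C_act]⟩

lemma mem_of_int {z : V} (h : ∀ p : ℕ, z ∈ LL p) : z ∈ GG v := fun p _ => loc_of_LL (h p)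

noncomputable def e10 : GG v := ⟨v0, mem_of_int fun p => ⟨(EE p).one_mem, fun _ => (O p).zero_mem⟩⟩
noncomputable def e01 : GG v := ⟨(0, 1), mem_of_int fun p => ⟨(EE p).zero_mem, fun _ => (O p).one_mem⟩⟩
noncomputable def eX : GG v := ⟨(X, 0), mem_of_int fun p => ⟨X_mem_EE, fun _ => (O p).zero_mem⟩⟩

lemma not_skip_of {w : V} (h : ∀ c : ℚ, w ≠ (C c, 0)) : ¬ Skip w := by
  rintro ⟨c, hc⟩
  exact h c (by rw [hc]; ext1 <;> simp [v0, smul_eq_C_mul])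

lemma map_e10 (hv2 : ∀ w, ¬ Skip w → {p : ℕ | p.Prime ∧ v p = w}.Infinite)
    (φ : GG v →+ GG v) : (φ e10).1.2 = 0 := by
  have h1 : ¬ Skip (eX : GG v).1 := by
    apply not_skip_of
    intro c hc
    have := congrArg (fun z : V => z.1.coeff 1) hc
    simp [eX] at this
  have h2 : ¬ Skip (eX + e10 : GG v).1 := by
    apply not_skip_of
    intro c hc
    have := congrArg (fun z : V => z.1.coeff 1) hc
    simp [eX, e10, v0, coeff_one] at this
  obtain ⟨a, ha⟩ := typ hv2 h1 (heightLE_map φ _)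
  obtain ⟨b, hb⟩ := typ hv2 h2 (heightLE_map φ _)
  have h3 : (φ eX).1.2 = 0 := by rw [ha]; simp [act, eX]
  have h4 : (φ (eX + e10)).1.2 = 0 := by rw [hb]; simp [act, eX, e10, v0]
  rw [map_add] at h4
  simpa [h3] using h4

lemma e10_height (hv1 : ∀ p, p.Prime → v p ∈ LL p ∧ ¬ Near p (v p) v0) {p : ℕ} (hp : p.Prime) :
    ¬ Divides p (e10 : GG v) := fun h => (hv1 p hp).2 (near_of_dvd hp h)

lemma not_fully (hv1 : ∀ p, p.Prime → v p ∈ LL p ∧ ¬ Near p (v p) v0)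
    (hv2 : ∀ w, ¬ Skip w → {p : ℕ | p.Prime ∧ v p = w}.Infinite) : ¬ FullyTransitive (GG v) := by
  intro h
  obtain ⟨φ, hφ⟩ := h e10 e01 (by
    intro p k hp hd
    rcases k with _ | k
    · exact ⟨e01, by simp⟩
    · obtain ⟨z, hz⟩ := hd
      exact absurd ⟨p ^ k • z, by rw [smul_smul, ← pow_succ', hz]⟩ (e10_height hv1 hp))
  have := map_e10 hv2 φ
  rw [hφ] at this
  simp [e01] at this

lemma not_transitive (hv1 : ∀ p, p.Prime → v p ∈ LL p ∧ ¬ Near p (v p) v0)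
    (hv2 : ∀ w, ¬ Skip w → {p : ℕ | p.Prime ∧ v p = w}.Infinite) : ¬ TransitiveGrp (GG v) := by
  intro h
  let t : GG v →+ GG v := endo X (fun _ _ => X_mem_EE)
  have ht : t (2 • e01) = e01 := by
    ext1
    simp [t, endo, e01, act]
  obtain ⟨φ, hφ⟩ := h e01 (2 • e01) ⟨fun p k _ ⟨z, hz⟩ => ⟨2 • z, by rw [smul_comm, hz]⟩, by
    have := heightLE_map t (2 • e01)
    rwa [ht] at this⟩
  have hu2 : (φ e10).1.2 = 0 := map_e10 hv2 φ.toAddMonoidHom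
  have h11 : ¬ Skip (e10 + e01 : GG v).1 := by
    apply not_skip_of
    intro c hc
    have := congrArg (fun z : V => z.2) hc
    simp [e01, e10, v0] at this
  obtain ⟨g, hg⟩ := typ hv2 h11 (heightLE_map φ.toAddMonoidHom _)
  have hg' : (φ e10).1 + (φ e01).1 = act g ((e10 : GG v).1 + (e01 : GG v).1) := by
    rw [← AddSubgroup.coe_add, ← map_add]; exact hg
  rw [hφ] at hg'
  have hg1 : (φ e10).1.1 = g := by
    have := congrArg Prod.fst hg'
    simpa [e10, e01, act, v0] using this
  have hg2 : g.eval (1/2) = 2 := by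
    have := congrArg Prod.snd hg'
    rw [Prod.snd_add, hu2] at this
    simpa [e10, e01, act, v0] using this.symm
  by_cases hs : Skip (φ e10).1
  · obtain ⟨c, hc⟩ := hs
    have hgc : g = C c := by
      rw [← hg1, hc]; simp [v0, smul_eq_C_mul]
    have hc2 : c = 2 := by rw [hgc, eval_C] at hg2; exact hg2
    have h2 : φ e10 = 2 • e10 := by
      ext1
      rw [hc, hc2]
      rw [show (2 : ℚ) = ((2 : ℕ) : ℚ) by norm_num, Nat.cast_smul_eq_nsmul]; rfl
    apply e10_height hv1 Nat.prime_two
    refine ⟨φ.symm e10, ?_⟩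
    rw [← map_nsmul, ← h2, AddEquiv.symm_apply_apply]
  · obtain ⟨b, hb⟩ := typ hv2 hs (heightLE_map φ.symm.toAddMonoidHom _)
    have hb' : (1 : ℚ) • v0 = act b (φ e10).1 := by
      rw [one_smul, ← hb]
      simp [e10]
    exact hs (skip_of_act one_ne_zero hb')

end

lemma square_not {G : Type*} [AddCommGroup G] (h : ¬ FullyTransitive G) :
    ¬ KrylovTransitive (G × G) := by
  intro hk
  apply h
  intro x y hxy
  obtain ⟨φ, hφ⟩ := hk (x, 0) (x, y) ⟨by
    rintro p k hp ⟨z, hz⟩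
    obtain ⟨w, hw⟩ := hxy p k hp ⟨z.1, congrArg Prod.fst hz⟩
    have h1 : p ^ k • z.1 = x := congrArg Prod.fst hz
    exact ⟨(z.1, w), Prod.ext h1 hw⟩, by
    rintro p k hp ⟨z, hz⟩
    have h1 : p ^ k • z.1 = x := congrArg Prod.fst hz
    exact ⟨(z.1, 0), Prod.ext h1 (by simp)⟩⟩
  refine ⟨(AddMonoidHom.snd G G).comp (φ.comp (AddMonoidHom.inl G G)), ?_⟩
  simp [hφ]

lemma torsion_free (v : ℕ → V) : IsTorsionFreeGrp (GG v) := by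
  intro n x hn h
  have h1 : n • x.1 = 0 := congrArg Subtype.val h
  rw [← Int.cast_smul_eq_zsmul ℚ, smul_eq_zero] at h1
  rcases h1 with h1 | h1
  · exact absurd (by exact_mod_cast h1) hn
  · exact Subtype.ext h1

end Kry

theorem stmt_15 : ∃ (G : Type) (_ : AddCommGroup G),
    IsTorsionFreeGrp G ∧ KrylovTransitive G ∧ ¬ TransitiveGrp G ∧
      ¬ FullyTransitive G ∧ ¬ KrylovTransitive (G × G) := by
  obtain ⟨v, hv1, hv2⟩ := Kry.exists_v
  exact ⟨Kry.GG v, inferInstance, Kry.torsion_free v, Kry.krylov (fun p hp => (hv1 p hp).1) hv2,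
    Kry.not_transitive hv1 hv2, Kry.not_fully hv1 hv2, Kry.square_not (Kry.not_fully hv1 hv2)⟩
end

section
/- Let A and B be torsion-free abelian groups that are both weakly transitive, such that every additive homomorphism A → B is zero, every additive homomorphism B → A is zero, and there is a prime p with pA ≠ A and pB ≠ B. Then G = A × B is weakly transitive, but neither transitive nor fully transitive. -/
theorem divides_smul {G : Type*} [AddCommGroup G] {n : ℕ} (m : ℕ) {x : G}
    (h : Divides n x) : Divides n (m • x) := by
  obtain ⟨z, rfl⟩ := h
  exact ⟨m • z, smul_comm _ _ _⟩

theorem divides_of_coprime {G : Type*} [AddCommGroup G] {n p : ℕ} (hc : Nat.Coprime n p) {x : G}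
    (h : Divides n (p • x)) : Divides n x := by
  obtain ⟨z, hz⟩ := h
  have hb := Nat.gcd_eq_gcd_ab n p
  rw [hc] at hb
  refine ⟨Nat.gcdA n p • x + Nat.gcdB n p • z, ?_⟩
  have hz' : (n : ℤ) • z = (p : ℤ) • x := by simpa using hz
  calc n • (Nat.gcdA n p • x + Nat.gcdB n p • z)
      = ((n : ℤ) * Nat.gcdA n p) • x + Nat.gcdB n p • ((n : ℤ) • z) := by
        rw [← natCast_zsmul, smul_add, smul_smul, smul_comm (n : ℤ)]
    _ = ((n : ℤ) * Nat.gcdA n p + (p : ℤ) * Nat.gcdB n p) • x := by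
        rw [hz', smul_smul, ← add_smul, mul_comm (Nat.gcdB n p)]
    _ = x := by rw [← hb]; simp

theorem divides_prod {A B : Type*} [AddCommGroup A] [AddCommGroup B] {n : ℕ} {a : A} {b : B} :
    Divides n (a, b) ↔ Divides n a ∧ Divides n b := by
  constructor
  · rintro ⟨⟨u, v⟩, h⟩
    exact ⟨⟨u, congrArg Prod.fst h⟩, ⟨v, congrArg Prod.snd h⟩⟩
  · rintro ⟨⟨u, hu⟩, ⟨v, hv⟩⟩
    exact ⟨(u, v), Prod.ext hu hv⟩

theorem heightLE_swap {A B : Type*} [AddCommGroup A] [AddCommGroup B] {p : ℕ} (hp : p.Prime)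
    {a : A} {b : B} (hab : ¬ (Divides p a ∧ Divides p (p • b))) :
    HeightLE (a, p • b) (p • a, b) := by
  intro q k hq h
  rw [divides_prod] at h ⊢
  refine ⟨divides_smul _ h.1, ?_⟩
  by_cases hqp : q = p
  · subst hqp
    cases k with
    | zero => exact ⟨b, by simp⟩
    | succ k =>
      exfalso
      apply hab
      refine ⟨?_, b, rfl⟩
      obtain ⟨z, hz⟩ := h.1
      exact ⟨q ^ k • z, by rw [smul_smul, ← pow_succ', hz]⟩
  · exact divides_of_coprime (((Nat.coprime_primes hq hp).2 hqp).pow_left k) h.2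

theorem heightLE_comm {A B : Type*} [AddCommGroup A] [AddCommGroup B] {a a' : A} {b b' : B}
    (h : HeightLE (b, a) (b', a')) : HeightLE (a, b) (a', b') := by
  intro q k hq
  have := h q k hq
  simp only [divides_prod] at this ⊢
  tauto

theorem end_diag {A B : Type*} [AddCommGroup A] [AddCommGroup B]
    (hAB : ∀ f : A →+ B, f = 0) (hBA : ∀ g : B →+ A, g = 0) (φ : A × B →+ A × B) (a : A) (b : B) :
    φ (a, b) = (((AddMonoidHom.fst A B).comp (φ.comp (AddMonoidHom.inl A B))) a,
      ((AddMonoidHom.snd A B).comp (φ.comp (AddMonoidHom.inr A B))) b) := by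
  have h1 := DFunLike.congr_fun (hAB ((AddMonoidHom.snd A B).comp (φ.comp (AddMonoidHom.inl A B)))) a
  have h2 := DFunLike.congr_fun (hBA ((AddMonoidHom.fst A B).comp (φ.comp (AddMonoidHom.inr A B)))) b
  have h : φ (a, b) = φ (a, 0) + φ (0, b) := by rw [← map_add]; simp
  simp at h1 h2
  rw [h]
  ext <;> simp [h1, h2]

theorem stmt_17 (A B : Type*) [AddCommGroup A] [AddCommGroup B]
    (hA : IsTorsionFreeGrp A) (hB : IsTorsionFreeGrp B)
    (hwA : WeaklyTransitive A) (hwB : WeaklyTransitive B)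
    (hAB : ∀ f : A →+ B, f = 0) (hBA : ∀ g : B →+ A, g = 0)
    (hp : ∃ p : ℕ, p.Prime ∧ ¬ (∀ a : A, ∃ z : A, p • z = a) ∧
      ¬ (∀ b : B, ∃ z : B, p • z = b)) :
    WeaklyTransitive (A × B) ∧ ¬ TransitiveGrp (A × B) ∧ ¬ FullyTransitive (A × B) := by
  have key : ∃ x y : A × B, HeightEq x y ∧ ∀ φ : A × B →+ A × B, φ x ≠ y := by
    obtain ⟨p, hp, ha, hb⟩ := hp
    push Not at ha hb
    obtain ⟨a, ha⟩ := ha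
    obtain ⟨b, hb⟩ := hb
    refine ⟨(a, p • b), (p • a, b), ⟨?_, ?_⟩, ?_⟩
    · exact heightLE_swap hp (fun h => h.1.elim ha)
    · exact heightLE_comm (heightLE_swap hp (fun h => h.1.elim hb))
    · intro φ h
      rw [end_diag hAB hBA] at h
      have h2 := congrArg Prod.snd h
      simp only [map_nsmul] at h2
      exact hb _ h2
  obtain ⟨x, y, hxy, hno⟩ := key
  refine ⟨?_, ?_, ?_⟩
  · rintro ⟨a, b⟩ ⟨a', b'⟩ φ ψ h1 h2
    rw [end_diag hAB hBA] at h1 h2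
    obtain ⟨α, hα⟩ := hwA a a' _ _ (congrArg Prod.fst h1) (congrArg Prod.fst h2)
    obtain ⟨β, hβ⟩ := hwB b b' _ _ (congrArg Prod.snd h1) (congrArg Prod.snd h2)
    exact ⟨α.prodCongr β, Prod.ext hα hβ⟩
  · intro ht
    obtain ⟨η, hη⟩ := ht x y hxy
    exact hno η.toAddMonoidHom hη
  · intro hf
    obtain ⟨φ, hφ⟩ := hf x y hxy.1
    exact hno φ hφ
end
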